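/- Let c_P(t) = Σ_{i=0}^n b_{i,n}(t) p_i be a Bézier curve of degree n with control points p_0, …, p_n ∈ ℝ^d. Then the squared L² norm of the curve satisfies ∫₀¹ ‖c_P(t)‖² dt = Σ_{i=0}^n Σ_{j=0}^n (1/(2n+1)) · (C(n,i)·C(n,j))/C(2n, i+j) · ⟨p_i, p_j⟩, where ‖·‖ is the Euclidean norm and ⟨·,·⟩ the Euclidean inner product on ℝ^d. -/

import Mathlib

open scoped RealInnerProductSpace

/-- The Bernstein basis polynomial `b_{i,n}(t) = C(n,i) tⁱ (1-t)^{n-i}`. -/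
noncomputable def bern (n i : ℕ) (t : ℝ) : ℝ :=
  (n.choose i : ℝ) * t ^ i * (1 - t) ^ (n - i)

/-- The Bézier curve of degree `n` with control points `p 0, …, p n` in `ℝ^d`. -/
noncomputable def bezier (d n : ℕ) (p : ℕ → EuclideanSpace ℝ (Fin d)) (t : ℝ) :
    EuclideanSpace ℝ (Fin d) :=
  ∑ i ∈ Finset.range (n + 1), bern n i t • p i

/-- The beta integral at natural-number exponents. -/
theorem integral_pow_mul_one_sub_pow (a b : ℕ) :
    ∫ t in (0:ℝ)..1, t ^ a * (1 - t) ^ b =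
      (a.factorial * b.factorial : ℝ) / (a + b + 1).factorial := by
  induction b generalizing a with
  | zero =>
    simp only [pow_zero, mul_one, integral_pow, Nat.factorial_succ, add_zero]
    have := Nat.factorial_ne_zero a
    push_cast
    field_simp
    simp
  | succ b ih =>
    have hderiv (t : ℝ) : HasDerivAt (fun t : ℝ => t ^ (a + 1) * (1 - t) ^ (b + 1))
        ((a + 1) * (t ^ a * (1 - t) ^ (b + 1)) - (b + 1) * (t ^ (a + 1) * (1 - t) ^ b)) t := by
      refine ((hasDerivAt_pow (a + 1) t).mul
        (((hasDerivAt_id t).const_sub 1).pow (b + 1))).congr_deriv ?_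
      simp
      ring
    have hparts := intervalIntegral.integral_eq_sub_of_hasDerivAt (a := 0) (b := 1)
      (fun t _ => hderiv t) (Continuous.intervalIntegrable (by fun_prop) _ _)
    rw [intervalIntegral.integral_sub (Continuous.intervalIntegrable (by fun_prop) _ _)
      (Continuous.intervalIntegrable (by fun_prop) _ _), intervalIntegral.integral_const_mul,
      intervalIntegral.integral_const_mul, ih (a + 1)] at hparts
    have ha : (a + 1 : ℝ) ≠ 0 := by positivity
    apply mul_left_cancel₀ ha
    rw [show a + 1 + b + 1 = a + (b + 1) + 1 by ring, Nat.factorial_succ a] at hparts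
    rw [Nat.factorial_succ b]
    simp only [sub_self, ne_eq, Nat.add_eq_zero_iff, one_ne_zero, and_false, not_false_eq_true,
      zero_pow, mul_zero, zero_mul] at hparts
    push_cast at hparts ⊢
    linear_combination hparts

/-- The Gram matrix of the Bernstein basis in `L²[0, 1]`. -/
theorem integral_bern_mul_bern {n i j : ℕ} (hi : i ≤ n) (hj : j ≤ n) :
    ∫ t in (0:ℝ)..1, bern n i t * bern n j t =
      (1 / (2 * (n : ℝ) + 1)) * ((n.choose i : ℝ) * (n.choose j : ℝ)) /
        ((2 * n).choose (i + j) : ℝ) := by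
  have hprod (t : ℝ) : bern n i t * bern n j t =
      ((n.choose i : ℝ) * n.choose j) * (t ^ (i + j) * (1 - t) ^ (2 * n - (i + j))) := by
    rw [show 2 * n - (i + j) = (n - i) + (n - j) by lia, bern, bern]
    ring
  simp only [hprod]
  rw [intervalIntegral.integral_const_mul, integral_pow_mul_one_sub_pow,
    Nat.cast_choose ℝ (show i + j ≤ 2 * n by lia),
    show i + j + (2 * n - (i + j)) + 1 = 2 * n + 1 by lia, Nat.factorial_succ]
  push_cast
  field_simp

theorem continuous_bern (n i : ℕ) : Continuous (bern n i) := by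
  unfold bern
  fun_prop

/-- The squared L² norm of a Bézier curve is a quadratic form in its control points,
with Hessian given by the Bézier norm Hessian `H_N(n)`. -/
theorem bezier_norm_sq (d n : ℕ) (p : ℕ → EuclideanSpace ℝ (Fin d)) :
    ∫ t in (0:ℝ)..1, ‖bezier d n p t‖ ^ 2 =
      ∑ i ∈ Finset.range (n + 1), ∑ j ∈ Finset.range (n + 1),
        (1 / (2 * (n : ℝ) + 1)) * ((n.choose i : ℝ) * (n.choose j : ℝ)) /
          ((2 * n).choose (i + j) : ℝ) * ⟪p i, p j⟫ := by
  have hnorm (t : ℝ) : ‖bezier d n p t‖ ^ 2 =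
      ∑ i ∈ Finset.range (n + 1), ∑ j ∈ Finset.range (n + 1),
        bern n i t * bern n j t * ⟪p i, p j⟫ := by
    simp only [← real_inner_self_eq_norm_sq, bezier, sum_inner, inner_sum,
      real_inner_smul_left, real_inner_smul_right, mul_assoc]
    exact Finset.sum_congr rfl fun i _ => Finset.sum_congr rfl fun j _ => by
      rw [real_inner_comm]
  have hint (i j : ℕ) : Continuous fun t => bern n i t * bern n j t * ⟪p i, p j⟫ :=
    ((continuous_bern n i).mul (continuous_bern n j)).mul continuous_const
  simp only [hnorm]
  rw [intervalIntegral.integral_finsetSum fun i _ =>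
    (continuous_finsetSum _ fun j _ => hint i j).intervalIntegrable _ _]
  refine Finset.sum_congr rfl fun i hi => ?_
  rw [intervalIntegral.integral_finsetSum fun j _ => (hint i j).intervalIntegrable _ _]
  refine Finset.sum_congr rfl fun j hj => ?_
  rw [intervalIntegral.integral_mul_const, integral_bern_mul_bern
    (Finset.mem_range_succ_iff.mp hi) (Finset.mem_range_succ_iff.mp hj)]
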